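/- arXiv:0804.3551 — 3 statements merged into one kernel-verified Lean document; each statement's English description precedes it below -/
import Mathlib

section
/- Gelfand–Naimark theorem for I*-algebras: Let (I, C) be an I*-algebra with C commutative. Then the character space Ĉ, equipped with the weak-* topology and the partial order φ ≤ ψ ⇔ ∀ c ∈ I, φ(c) ≤ ψ(c), is a compact toposet, and the Gelfand transform maps I isometrically onto I(Ĉ), the cone of continuous isotone real-valued functions on Ĉ. -/
noncomputable section

def cstarVee {A : Type*} [CStarAlgebra A] [PartialOrder A] [StarOrderedRing A] (a b : A) : A :=
  (2 : ℝ)⁻¹ • (a + b + CFC.sqrt (star (a - b) * (a - b)))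

def cstarWedge {A : Type*} [CStarAlgebra A] [PartialOrder A] [StarOrderedRing A] (a b : A) : A :=
  (2 : ℝ)⁻¹ • (a + b - CFC.sqrt (star (a - b) * (a - b)))

structure IsIsocone (A : Type*) [CStarAlgebra A] [PartialOrder A] [StarOrderedRing A]
    (I : Set A) : Prop where
  selfAdjoint : ∀ a ∈ I, IsSelfAdjoint a
  closed : IsClosed I
  add_mem : ∀ a ∈ I, ∀ b ∈ I, a + b ∈ I
  smul_mem : ∀ (r : ℝ), 0 ≤ r → ∀ a ∈ I, r • a ∈ I
  vee_mem : ∀ a ∈ I, ∀ b ∈ I, cstarVee a b ∈ I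
  wedge_mem : ∀ a ∈ I, ∀ b ∈ I, cstarWedge a b ∈ I
  const_mem : ∀ r : ℝ, r • (1 : A) ∈ I
  dense_span : Dense (Submodule.span ℂ I : Set A)

/-- A continuous function on a compact space that can be interpolated at every pair of points by
elements of a nonempty lattice of continuous functions is a uniform limit of such elements. -/
theorem ContinuousMap.mem_closure_of_sublattice_of_interpolates {X : Type*} [TopologicalSpace X]
    [CompactSpace X] {L : Set C(X, ℝ)} (hL : L.Nonempty)
    (inf_mem : ∀ f ∈ L, ∀ g ∈ L, f ⊓ g ∈ L) (sup_mem : ∀ f ∈ L, ∀ g ∈ L, f ⊔ g ∈ L)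
    (f : C(X, ℝ)) (hf : ∀ x y, ∃ g ∈ L, g x = f x ∧ g y = f y) : f ∈ closure L := by
  rw [Metric.mem_closure_iff]
  intro ε pos
  rcases isEmpty_or_nonempty X with hX | hX
  · exact ⟨hL.some, hL.some_mem, (ContinuousMap.dist_lt_iff pos).mpr fun x => hX.elim x⟩
  choose g hg hgx hgy using hf
  have above : ∀ x, ∃ h ∈ L, (∀ z, f z - ε < h z) ∧ h x = f x := by
    intro x
    obtain ⟨t, ht⟩ := CompactSpace.elim_nhds_subcover (fun y => {z | f z - ε < g x y z})
      fun y => (isOpen_lt (by fun_prop) (by fun_prop)).mem_nhds (by simp [hgy, pos])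
    have tne : t.Nonempty := Set.nonempty_of_union_eq_top_of_nonempty _ _ hX ht
    refine ⟨t.sup' tne (g x), Finset.sup'_mem _ sup_mem _ _ _ fun y _ => hg x y, fun z => ?_, ?_⟩
    · obtain ⟨y, hy, hz⟩ := Set.exists_set_mem_of_union_eq_top _ _ ht z
      rw [ContinuousMap.sup'_apply, Finset.lt_sup'_iff]
      exact ⟨y, hy, hz⟩
    · simp [hgx]
  choose h hL' hlt heq using above
  obtain ⟨t, ht⟩ := CompactSpace.elim_nhds_subcover (fun x => {z | h x z < f z + ε})
    fun x => (isOpen_lt (by fun_prop) (by fun_prop)).mem_nhds (by simp [heq, pos])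
  have tne : t.Nonempty := Set.nonempty_of_union_eq_top_of_nonempty _ _ hX ht
  refine ⟨t.inf' tne h, Finset.inf'_mem _ inf_mem _ _ _ fun x _ => hL' x,
    (ContinuousMap.dist_lt_iff pos).mpr fun z => ?_⟩
  rw [Real.dist_eq, abs_sub_lt_iff, ContinuousMap.inf'_apply]
  constructor
  · have : f z - ε < t.inf' tne fun x => h x z := by
      rw [Finset.lt_inf'_iff]
      exact fun x _ => hlt x z
    linarith
  · obtain ⟨x, hx, hz⟩ := Set.exists_set_mem_of_union_eq_top _ _ ht z
    have : (t.inf' tne fun x => h x z) < f z + ε := by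
      rw [Finset.inf'_lt_iff]
      exact ⟨x, hx, hz⟩
    linarith

namespace WeakDual.CharacterSpace

variable {A : Type*} [CommCStarAlgebra A]

theorem apply_eq_re_of_isSelfAdjoint {a : A} (ha : IsSelfAdjoint a) (χ : characterSpace ℂ A) :
    χ a = ((χ a).re : ℂ) :=
  (Complex.conj_eq_iff_re.mp (by rw [starRingEnd_apply, ← map_star, ha.star_eq])).symm

theorem re_apply_real_smul (χ : characterSpace ℂ A) (r : ℝ) (a : A) :
    (χ (r • a)).re = r * (χ a).re := by
  rw [← Complex.coe_smul, map_smul, smul_eq_mul, Complex.re_ofReal_mul]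

/-- The real part of the Gelfand transform of an element. -/
def reGelfand (a : A) : C(characterSpace ℂ A, ℝ) :=
  ⟨fun χ => (χ a).re, Complex.continuous_re.comp (gelfandTransform ℂ A a).continuous⟩

@[simp]
theorem reGelfand_apply (a : A) (χ : characterSpace ℂ A) : reGelfand a χ = (χ a).re := rfl

theorem norm_reGelfand {a : A} (ha : IsSelfAdjoint a) : ‖reGelfand a‖ = ‖a‖ := by
  have h : ∀ χ, ‖reGelfand a χ‖ = ‖gelfandTransform ℂ A a χ‖ := fun χ => by
    rw [gelfandTransform_apply_apply, apply_eq_re_of_isSelfAdjoint ha, Complex.norm_real,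
      reGelfand_apply]
  rw [← (gelfandTransform_isometry A).norm_map_of_map_zero (map_zero _) a,
    ContinuousMap.norm_eq_iSup_norm, ContinuousMap.norm_eq_iSup_norm]
  exact iSup_congr h

theorem reGelfand_sub (a b : A) : reGelfand (a - b) = reGelfand a - reGelfand b := by
  ext χ
  simp

theorem exists_isSelfAdjoint_reGelfand_eq (f : C(characterSpace ℂ A, ℝ)) :
    ∃ a : A, IsSelfAdjoint a ∧ reGelfand a = f := by
  obtain ⟨a, ha⟩ := (gelfandTransform_bijective A).surjective
    ⟨fun χ => (f χ : ℂ), Complex.continuous_ofReal.comp f.continuous⟩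
  have h : ∀ χ : characterSpace ℂ A, χ a = f χ := fun χ => DFunLike.congr_fun ha χ
  refine ⟨a, (gelfandTransform_isometry A).injective ?_, ?_⟩
  · ext χ
    simp [map_star, h]
  · ext χ
    simp [h]

variable [PartialOrder A] [StarOrderedRing A]

open scoped ComplexOrder in
theorem re_apply_sqrt_star_mul_self {a : A} (ha : IsSelfAdjoint a) (χ : characterSpace ℂ A) :
    (χ (CFC.sqrt (star a * a))).re = |(χ a).re| := by
  have hs := CFC.sqrt_nonneg (star a * a)
  have hχ : 0 ≤ χ (CFC.sqrt (star a * a)) := map_nonneg χ hs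
  have key : χ (CFC.sqrt (star a * a)) * χ (CFC.sqrt (star a * a)) = χ a * χ a := by
    rw [← map_mul, CFC.sqrt_mul_sqrt_self _ (star_mul_self_nonneg a), ha.star_eq, map_mul]
  rw [apply_eq_re_of_isSelfAdjoint ha, apply_eq_re_of_isSelfAdjoint hs.isSelfAdjoint] at key
  norm_cast at key
  rw [← abs_of_nonneg (a := (χ (CFC.sqrt (star a * a))).re) (Complex.le_def.mp hχ).1]
  exact (mul_self_eq_mul_self_iff.mp key).elim (fun h => by simp [h]) fun h => by simp [h]

theorem reGelfand_cstarVee {a b : A} (ha : IsSelfAdjoint a) (hb : IsSelfAdjoint b) :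
    reGelfand (cstarVee a b) = reGelfand a ⊔ reGelfand b := by
  ext χ
  rw [ContinuousMap.sup_apply, sup_eq_half_smul_add_add_abs_sub' ℝ, cstarVee, reGelfand_apply,
    re_apply_real_smul, map_add, map_add, Complex.add_re, Complex.add_re,
    re_apply_sqrt_star_mul_self (ha.sub hb), map_sub, Complex.sub_re, abs_sub_comm]
  rfl

theorem reGelfand_cstarWedge {a b : A} (ha : IsSelfAdjoint a) (hb : IsSelfAdjoint b) :
    reGelfand (cstarWedge a b) = reGelfand a ⊓ reGelfand b := by
  ext χ
  rw [ContinuousMap.inf_apply, inf_eq_half_smul_add_sub_abs_sub' ℝ, cstarWedge, reGelfand_apply,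
    re_apply_real_smul, map_sub, map_add, Complex.sub_re, Complex.add_re,
    re_apply_sqrt_star_mul_self (ha.sub hb), map_sub, Complex.sub_re, abs_sub_comm]
  rfl

end WeakDual.CharacterSpace

namespace IsIsocone

open WeakDual WeakDual.CharacterSpace

variable {A : Type*} [CommCStarAlgebra A] [PartialOrder A] [StarOrderedRing A] {I : Set A}

theorem characterSpace_ext (hI : IsIsocone A I) {φ ψ : characterSpace ℂ A}
    (h : ∀ c ∈ I, (φ c).re = (ψ c).re) : φ = ψ := by
  have hc : ∀ c ∈ I, φ c = ψ c := fun c hc => by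
    rw [apply_eq_re_of_isSelfAdjoint (hI.selfAdjoint c hc) φ,
      apply_eq_re_of_isSelfAdjoint (hI.selfAdjoint c hc) ψ, h c hc]
  exact Subtype.ext (ContinuousLinearMap.ext_on hI.dense_span hc)

theorem exists_reGelfand_interpolates_of_lt (hI : IsIsocone A I) {φ ψ : characterSpace ℂ A}
    {c : A} (hc : c ∈ I) (h : (φ c).re < (ψ c).re) {s t : ℝ} (hst : s ≤ t) :
    ∃ d ∈ I, reGelfand d φ = s ∧ reGelfand d ψ = t := by
  have hpos : 0 < (ψ c).re - (φ c).re := sub_pos.mpr h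
  let r := (t - s) / ((ψ c).re - (φ c).re)
  refine ⟨r • c + (s - r * (φ c).re) • 1, hI.add_mem _ (hI.smul_mem r
    (div_nonneg (sub_nonneg.mpr hst) hpos.le) c hc) _ (hI.const_mem _), ?_, ?_⟩
  · rw [reGelfand_apply, map_add, Complex.add_re, re_apply_real_smul, re_apply_real_smul, map_one,
      Complex.one_re]
    ring
  · have : r * ((ψ c).re - (φ c).re) = t - s := div_mul_cancel₀ _ hpos.ne'
    rw [reGelfand_apply, map_add, Complex.add_re, re_apply_real_smul, re_apply_real_smul, map_one,
      Complex.one_re]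
    linarith

theorem exists_reGelfand_interpolates (hI : IsIsocone A I) {f : C(characterSpace ℂ A, ℝ)}
    (hf : ∀ φ ψ : characterSpace ℂ A, (∀ c ∈ I, (φ c).re ≤ (ψ c).re) → f φ ≤ f ψ)
    (φ ψ : characterSpace ℂ A) : ∃ c ∈ I, reGelfand c φ = f φ ∧ reGelfand c ψ = f ψ := by
  rcases lt_trichotomy (f φ) (f ψ) with h | h | h
  · obtain ⟨c, hc, hlt⟩ : ∃ c ∈ I, (φ c).re < (ψ c).re := by
      by_contra! hle
      exact h.not_ge (hf ψ φ hle)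
    exact hI.exists_reGelfand_interpolates_of_lt hc hlt h.le
  · refine ⟨f φ • 1, hI.const_mem _, ?_, ?_⟩ <;>
      rw [reGelfand_apply, re_apply_real_smul, map_one, Complex.one_re, mul_one]
    exact h
  · obtain ⟨c, hc, hlt⟩ : ∃ c ∈ I, (ψ c).re < (φ c).re := by
      by_contra! hle
      exact h.not_ge (hf φ ψ hle)
    obtain ⟨d, hd, hψ, hφ⟩ := hI.exists_reGelfand_interpolates_of_lt hc hlt h.le
    exact ⟨d, hd, hφ, hψ⟩

theorem exists_reGelfand_eq (hI : IsIsocone A I) {f : C(characterSpace ℂ A, ℝ)}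
    (hf : ∀ φ ψ : characterSpace ℂ A, (∀ c ∈ I, (φ c).re ≤ (ψ c).re) → f φ ≤ f ψ) :
    ∃ c ∈ I, reGelfand c = f := by
  have hcl : f ∈ closure (reGelfand '' I) := by
    refine ContinuousMap.mem_closure_of_sublattice_of_interpolates
      (Set.Nonempty.image _ ⟨_, hI.const_mem 0⟩) ?_ ?_ f fun φ ψ => ?_
    · rintro _ ⟨a, ha, rfl⟩ _ ⟨b, hb, rfl⟩
      exact ⟨_, hI.wedge_mem a ha b hb,
        reGelfand_cstarWedge (hI.selfAdjoint a ha) (hI.selfAdjoint b hb)⟩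
    · rintro _ ⟨a, ha, rfl⟩ _ ⟨b, hb, rfl⟩
      exact ⟨_, hI.vee_mem a ha b hb,
        reGelfand_cstarVee (hI.selfAdjoint a ha) (hI.selfAdjoint b hb)⟩
    · obtain ⟨c, hc, h⟩ := hI.exists_reGelfand_interpolates hf φ ψ
      exact ⟨_, ⟨c, hc, rfl⟩, h⟩
  obtain ⟨a, ha, rfl⟩ := exists_isSelfAdjoint_reGelfand_eq f
  refine ⟨a, hI.closed.closure_subset (Metric.mem_closure_iff.mpr fun ε hε => ?_), rfl⟩
  obtain ⟨_, ⟨c, hc, rfl⟩, h⟩ := Metric.mem_closure_iff.mp hcl ε hε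
  refine ⟨c, hc, ?_⟩
  rwa [dist_eq_norm, ← reGelfand_sub, norm_reGelfand (ha.sub (hI.selfAdjoint c hc)),
    ← dist_eq_norm] at h

end IsIsocone

open WeakDual in
/-- **Gelfand–Naimark theorem for `I*`-algebras.**  Let `(I, A)` be an `I*`-algebra with
`A` commutative.  Then the character space of `A`, with the weak-* topology and the
partial order `φ ≤ ψ ⇔ ∀ c ∈ I, φ(c) ≤ ψ(c)`, is a compact toposet, and the Gelfand
transform maps `I` isometrically onto the cone of continuous isotone real-valued
functions on the character space. -/
theorem stmt_11 {A : Type*} [CommCStarAlgebra A] [PartialOrder A] [StarOrderedRing A]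
    [Nontrivial A] {I : Set A} (hI : IsIsocone A I)
    (ord : characterSpace ℂ A → characterSpace ℂ A → Prop)
    (hord : ∀ φ ψ, ord φ ψ ↔ ∀ c ∈ I, (φ c).re ≤ (ψ c).re) :
    CompactSpace (characterSpace ℂ A) ∧
    -- `ord` is a partial order (it is clearly reflexive and transitive; antisymmetry:)
    (∀ φ ψ, ord φ ψ → ord ψ φ → φ = ψ) ∧
    -- the character space with this order is a toposet:
    (∀ φ ψ, ord φ ψ ↔
      ∀ f : C(characterSpace ℂ A, ℝ), (∀ χ χ', ord χ χ' → f χ ≤ f χ') → f φ ≤ f ψ) ∧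
    -- the (real part of the) Gelfand transform maps `I` onto the continuous isotone
    -- real-valued functions:
    (∀ f : C(characterSpace ℂ A, ℝ),
      (∀ χ χ', ord χ χ' → f χ ≤ f χ') ↔ ∃ c ∈ I, ∀ χ, f χ = (χ c).re) ∧
    -- and does so isometrically:
    (∀ c ∈ I, ∀ f : C(characterSpace ℂ A, ℝ), (∀ χ, f χ = (χ c).re) → ‖f‖ = ‖c‖) := by
  refine ⟨inferInstance, fun φ ψ h₁ h₂ => hI.characterSpace_ext fun c hc =>
    le_antisymm ((hord φ ψ).mp h₁ c hc) ((hord ψ φ).mp h₂ c hc), fun φ ψ => ⟨fun h f hf => hf φ ψ h,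
    fun h => (hord φ ψ).mpr fun c hc => h (CharacterSpace.reGelfand c)
      fun χ χ' hχ => (hord χ χ').mp hχ c hc⟩, fun f => ⟨fun hf => ?_, ?_⟩, ?_⟩
  · obtain ⟨c, hc, rfl⟩ := hI.exists_reGelfand_eq fun φ ψ h => hf φ ψ ((hord φ ψ).mpr h)
    exact ⟨c, hc, fun _ => rfl⟩
  · rintro ⟨c, hc, hf⟩ χ χ' hχ
    rw [hf, hf]
    exact (hord χ χ').mp hχ c hc
  · intro c hc f hf
    rw [← CharacterSpace.norm_reGelfand (hI.selfAdjoint c hc)]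
    exact congrArg _ (ContinuousMap.ext hf)

end
end

section
/- Let (I, C) be a finite-dimensional I*-algebra. Then the positive part I₊ = I ∩ C₊ is the set of nonnegative linear combinations of the projections it contains. -/
noncomputable section

/-- Elements of a finite-dimensional algebra over a field have finite spectrum. -/
theorem spectrum_finite_of_finiteDimensional {𝕜 A : Type*} [Field 𝕜] [Ring A] [Algebra 𝕜 A]
    [FiniteDimensional 𝕜 A] (a : A) : (spectrum 𝕜 a).Finite := by
  classical
  cases subsingleton_or_nontrivial A
  · simp [spectrum.of_subsingleton]
  have hint : IsIntegral 𝕜 a := Algebra.IsIntegral.isIntegral a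
  refine ((minpoly 𝕜 a).roots.toFinset.finite_toSet).subset fun x hx => ?_
  have h := spectrum.subset_polynomial_aeval a (minpoly 𝕜 a) ⟨x, hx, rfl⟩
  rw [minpoly.aeval, spectrum.zero_eq] at h
  simpa [minpoly.ne_zero hint] using h

/-- On a finite set of nonnegative reals, the identity is a nonnegative combination of the
indicators of the half-lines `[t, ∞)`. -/
theorem exists_nonneg_weights_eq_sum_indicator (S : Finset ℝ) (hS : ∀ x ∈ S, 0 ≤ x) :
    ∃ c : ℝ → ℝ, (∀ t ∈ S, 0 ≤ c t) ∧ (∀ x ∈ S, x = ∑ t ∈ S, c t * (if t ≤ x then 1 else 0)) ∧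
      ∀ m, 0 ≤ m → (∀ x ∈ S, x ≤ m) → ∑ t ∈ S, c t ≤ m := by
  induction S using Finset.induction_on_max with
  | empty => exact ⟨0, by simp, by simp, by simp⟩
  | insert m S hm ih =>
    obtain ⟨c, hc, hx, hs⟩ := ih fun x hx => hS x (Finset.mem_insert_of_mem hx)
    have hmS : m ∉ S := fun h => lt_irrefl _ (hm m h)
    have hne : ∀ t ∈ S, t ≠ m := fun t ht => (hm t ht).ne
    have hle := hs m (hS m (Finset.mem_insert_self _ _)) fun x hx => (hm x hx).le
    have hsum : ∀ g : ℝ → ℝ, ∑ t ∈ insert m S, Function.update c m (m - ∑ t ∈ S, c t) t * g t =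
        (m - ∑ t ∈ S, c t) * g m + ∑ t ∈ S, c t * g t := by
      intro g
      rw [Finset.sum_insert hmS, Function.update_self]
      congr 1
      exact Finset.sum_congr rfl fun t ht => by rw [Function.update_of_ne (hne t ht)]
    refine ⟨Function.update c m (m - ∑ t ∈ S, c t), ?_, ?_, ?_⟩
    · intro t ht
      rcases Finset.mem_insert.1 ht with rfl | ht
      · simpa using hle
      · rw [Function.update_of_ne (hne t ht)]
        exact hc t ht
    · intro x hxm
      rw [hsum fun t => if t ≤ x then 1 else 0]
      rcases Finset.mem_insert.1 hxm with rfl | hxS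
      · have : ∑ t ∈ S, c t * (if t ≤ x then 1 else 0) = ∑ t ∈ S, c t :=
          Finset.sum_congr rfl fun t ht => by rw [if_pos (hm t ht).le, mul_one]
        rw [this]
        simp
      · rw [if_neg (hm x hxS).not_ge, mul_zero, zero_add]
        exact hx x hxS
    · intro M _ hM
      have h := hsum fun _ => 1
      simp only [mul_one] at h
      rw [h]
      linarith [hM m (Finset.mem_insert_self _ _)]

/-- A finite set of reals leaves a gap just below each point. -/
theorem Finset.exists_pos_gap_below (S : Finset ℝ) (t : ℝ) :
    ∃ ε : ℝ, 0 < ε ∧ ∀ x ∈ S, x < t → x ≤ t - ε := by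
  induction S using Finset.induction_on with
  | empty => exact ⟨1, one_pos, by simp⟩
  | insert y S _ ih =>
    obtain ⟨ε, hε, h⟩ := ih
    by_cases hy : y < t
    · refine ⟨min ε (t - y), lt_min hε (sub_pos.2 hy), fun x hx hxt => ?_⟩
      rcases Finset.mem_insert.1 hx with rfl | hx
      · linarith [min_le_right ε (t - x)]
      · linarith [min_le_left ε (t - y), h x hx hxt]
    · refine ⟨ε, hε, fun x hx hxt => ?_⟩
      rcases Finset.mem_insert.1 hx with rfl | hx
      · exact absurd hxt hy
      · exact h x hx hxt

theorem isIdempotentElem_cfc_indicator {A : Type*} [CStarAlgebra A] (a : A)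
    (hfin : (spectrum ℝ a).Finite) (t : ℝ) :
    IsIdempotentElem (cfc (fun x => if t ≤ x then (1 : ℝ) else 0) a) := by
  have hc := hfin.continuousOn (fun x => if t ≤ x then (1 : ℝ) else 0)
  rw [IsIdempotentElem, ← cfc_mul _ _ a hc hc]
  exact cfc_congr fun x _ => by simp

section LatticeCalculus

variable {A : Type*} [CStarAlgebra A] [PartialOrder A] [StarOrderedRing A]

theorem sqrt_star_sub_mul_sub_cfc (a : A) (ha : IsSelfAdjoint a) (f g : ℝ → ℝ)
    (hf : ContinuousOn f (spectrum ℝ a)) (hg : ContinuousOn g (spectrum ℝ a)) :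
    CFC.sqrt (star (cfc f a - cfc g a) * (cfc f a - cfc g a)) =
      cfc (fun x => |f x - g x|) a := by
  change CFC.abs (cfc f a - cfc g a) = _
  rw [← cfc_sub f g a, CFC.abs_eq_cfc_norm _ (cfc_predicate _ a),
    ← cfc_comp' (fun x : ℝ => ‖x‖) (fun x => f x - g x) a]
  rfl

theorem cstarVee_cfc (a : A) (ha : IsSelfAdjoint a) (f g : ℝ → ℝ)
    (hf : ContinuousOn f (spectrum ℝ a)) (hg : ContinuousOn g (spectrum ℝ a)) :
    cstarVee (cfc f a) (cfc g a) = cfc (fun x => max (f x) (g x)) a := by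
  have habs : ContinuousOn (fun x => |f x - g x|) (spectrum ℝ a) := (hf.sub hg).abs
  rw [cstarVee, sqrt_star_sub_mul_sub_cfc a ha f g hf hg, ← cfc_add a f g,
    ← cfc_add a (fun x => f x + g x) (fun x => |f x - g x|) (hf.add hg) habs,
    ← cfc_smul (2 : ℝ)⁻¹ (fun x => f x + g x + |f x - g x|) a ((hf.add hg).add habs)]
  refine cfc_congr fun x _ => ?_
  simp only [smul_eq_mul]
  rcases le_total (f x) (g x) with h | h
  · rw [max_eq_right h, abs_of_nonpos (sub_nonpos.2 h)]; ring
  · rw [max_eq_left h, abs_of_nonneg (sub_nonneg.2 h)]; ring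

theorem cstarWedge_cfc (a : A) (ha : IsSelfAdjoint a) (f g : ℝ → ℝ)
    (hf : ContinuousOn f (spectrum ℝ a)) (hg : ContinuousOn g (spectrum ℝ a)) :
    cstarWedge (cfc f a) (cfc g a) = cfc (fun x => min (f x) (g x)) a := by
  have habs : ContinuousOn (fun x => |f x - g x|) (spectrum ℝ a) := (hf.sub hg).abs
  rw [cstarWedge, sqrt_star_sub_mul_sub_cfc a ha f g hf hg, ← cfc_add a f g,
    ← cfc_sub (fun x => f x + g x) (fun x => |f x - g x|) a (hf.add hg) habs,
    ← cfc_smul (2 : ℝ)⁻¹ (fun x => f x + g x - |f x - g x|) a ((hf.add hg).sub habs)]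
  refine cfc_congr fun x _ => ?_
  simp only [smul_eq_mul]
  rcases le_total (f x) (g x) with h | h
  · rw [min_eq_left h, abs_of_nonpos (sub_nonpos.2 h)]; ring
  · rw [min_eq_right h, abs_of_nonneg (sub_nonneg.2 h)]; ring

theorem IsIsocone.cfc_const_mem {I : Set A} (hI : IsIsocone A I) {a : A} (ha : IsSelfAdjoint a)
    (r : ℝ) : cfc (fun _ => r) a ∈ I := by
  rw [cfc_const r a, Algebra.algebraMap_eq_smul_one]
  exact hI.const_mem r

/-- Clamped affine functions with positive slope preserve an isocone. -/
theorem IsIsocone.cfc_clamp_mem {I : Set A} (hI : IsIsocone A I) {a : A} (haI : a ∈ I)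
    (s : ℝ) {k : ℝ} (hk : 0 ≤ k) : cfc (fun x => min (max (k * (x - s)) 0) 1) a ∈ I := by
  have ha := hI.selfAdjoint a haI
  have haff : cfc (fun x : ℝ => k * (x - s)) a ∈ I := by
    have h : cfc (fun x : ℝ => k * (x - s)) a = k • a + cfc (fun _ : ℝ => -(k * s)) a := by
      rw [← cfc_const_mul_id k a, ← cfc_add a (fun x : ℝ => k * x) (fun _ => -(k * s))]
      exact cfc_congr fun x _ => by ring
    rw [h]
    exact hI.add_mem _ (hI.smul_mem k hk a haI) _ (hI.cfc_const_mem ha _)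
  have hmax := hI.vee_mem _ haff _ (hI.cfc_const_mem ha 0)
  rw [cstarVee_cfc a ha _ _ (by fun_prop) (by fun_prop)] at hmax
  have hmin := hI.wedge_mem _ hmax _ (hI.cfc_const_mem ha 1)
  rwa [cstarWedge_cfc a ha _ _ (by fun_prop) (by fun_prop)] at hmin

/-- Upper spectral projections of elements of an isocone with finite spectrum belong to the
isocone. -/
theorem IsIsocone.cfc_indicator_mem {I : Set A} (hI : IsIsocone A I) {a : A} (haI : a ∈ I)
    (hfin : (spectrum ℝ a).Finite) (t : ℝ) : cfc (fun x => if t ≤ x then (1 : ℝ) else 0) a ∈ I := by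
  obtain ⟨ε, hε, hgap⟩ := hfin.toFinset.exists_pos_gap_below t
  convert hI.cfc_clamp_mem haI (t - ε) (inv_nonneg.2 hε.le) using 1
  refine cfc_congr fun x hx => ?_
  split_ifs with h
  · have h1 : 1 ≤ ε⁻¹ * (x - (t - ε)) := by
      rw [inv_mul_eq_div, one_le_div hε]
      linarith
    rw [min_eq_right (h1.trans (le_max_left _ _))]
  · have h1 : ε⁻¹ * (x - (t - ε)) ≤ 0 :=
      mul_nonpos_of_nonneg_of_nonpos (inv_nonneg.2 hε.le)
        (sub_nonpos.2 (hgap x (hfin.mem_toFinset.2 hx) (not_le.1 h)))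
    rw [max_eq_right h1, min_eq_left zero_le_one]

end LatticeCalculus

/-- Let `(I, C)` be a finite-dimensional `I*`-algebra.  Then
`I₊ = I ∩ C₊` is the set of nonnegative linear combinations of the projections it
contains. -/
theorem stmt_14 {A : Type*} [CStarAlgebra A] [PartialOrder A] [StarOrderedRing A]
    [FiniteDimensional ℂ A] {I : Set A} (hI : IsIsocone A I) :
    I ∩ {x : A | 0 ≤ x} =
      {a : A | ∃ (n : ℕ) (c : Fin n → ℝ) (p : Fin n → A),
        (∀ i, 0 ≤ c i) ∧
        (∀ i, p i ∈ I ∧ 0 ≤ p i ∧ IsSelfAdjoint (p i) ∧ IsIdempotentElem (p i)) ∧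
        a = ∑ i, c i • p i} := by
  ext a
  constructor
  · rintro ⟨haI, ha0 : 0 ≤ a⟩
    have ha := hI.selfAdjoint a haI
    have : FiniteDimensional ℝ A := FiniteDimensional.complexToReal A
    have hfin : (spectrum ℝ a).Finite := spectrum_finite_of_finiteDimensional a
    obtain ⟨c, hc, hx, -⟩ := exists_nonneg_weights_eq_sum_indicator hfin.toFinset
      fun x hx => spectrum_nonneg_of_nonneg ha0 (hfin.mem_toFinset.1 hx)
    let e := hfin.toFinset.equivFin.symm
    refine ⟨_, fun i => c (e i), fun i => cfc (fun x => if (e i : ℝ) ≤ x then (1 : ℝ) else 0) a,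
      fun i => hc _ (e i).2, fun i => ⟨hI.cfc_indicator_mem haI hfin _,
        cfc_nonneg fun x _ => by positivity, cfc_predicate _ a,
        isIdempotentElem_cfc_indicator a hfin _⟩, ?_⟩
    rw [e.sum_comp fun t => c t • cfc (fun x => if (t : ℝ) ≤ x then (1 : ℝ) else 0) a,
      Finset.sum_coe_sort hfin.toFinset
        fun t => c t • cfc (fun x => if t ≤ x then (1 : ℝ) else 0) a]
    calc a = cfc (∑ t ∈ hfin.toFinset, fun x => c t * if t ≤ x then (1 : ℝ) else 0) a := by
          conv_lhs => rw [← cfc_id ℝ a]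
          refine cfc_congr fun x hxs => ?_
          rw [Finset.sum_apply]
          exact hx x (hfin.mem_toFinset.2 hxs)
      _ = _ := by
          rw [cfc_sum _ a _ fun t _ => hfin.continuousOn _]
          exact Finset.sum_congr rfl fun t _ => cfc_smul (c t) _ a (hfin.continuousOn _)
  · rintro ⟨n, c, p, hc, hp, rfl⟩
    refine ⟨?_, Finset.sum_nonneg fun i _ => smul_nonneg (hc i) (hp i).2.1⟩
    refine Finset.sum_induction _ (· ∈ I) (fun x y hx hy => hI.add_mem x hx y hy) ?_
      fun i _ => hI.smul_mem _ (hc i) _ (hp i).1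
    simpa using hI.const_mem 0

end
end

section
/- Classification of isocones of M₂(ℂ): the map sending an isocone I of M₂(ℂ) to I ∩ T, where T is the real 3-dimensional space of traceless hermitian 2×2 matrices, is a bijection from the set of isocones of M₂(ℂ) onto the set of closed convex cones with nonempty interior in T, with inverse C ↦ C + ℝ·1. -/
open scoped ComplexOrder

noncomputable section

/-- The real subspace of traceless hermitian 2×2 matrices. -/
def tracelessHermitian : Set (Matrix (Fin 2) (Fin 2) ℂ) :=
  {m | IsSelfAdjoint m ∧ m.trace = 0}

/-- An isocone of `M₂(ℂ)`: a closed convex cone of hermitian matrices containing all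
real multiples of the identity, stable under `a ∨ b = (a+b)/2 + |a−b|/2` and
`a ∧ b = (a+b)/2 − |a−b|/2` (where `|a−b|` is the positive semidefinite square root of
`(a−b)²`), whose complex span is dense. -/
structure IsIsoconeM2 (I : Set (Matrix (Fin 2) (Fin 2) ℂ)) : Prop where
  selfAdjoint : ∀ a ∈ I, IsSelfAdjoint a
  closed : IsClosed I
  add_mem : ∀ a ∈ I, ∀ b ∈ I, a + b ∈ I
  smul_mem : ∀ (r : ℝ), 0 ≤ r → ∀ a ∈ I, r • a ∈ I
  const_mem : ∀ r : ℝ, r • (1 : Matrix (Fin 2) (Fin 2) ℂ) ∈ I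
  vee_mem : ∀ a ∈ I, ∀ b ∈ I, ∀ p : Matrix (Fin 2) (Fin 2) ℂ, p.PosSemidef →
    p * p = (a - b) * (a - b) → (2 : ℝ)⁻¹ • (a + b + p) ∈ I
  wedge_mem : ∀ a ∈ I, ∀ b ∈ I, ∀ p : Matrix (Fin 2) (Fin 2) ℂ, p.PosSemidef →
    p * p = (a - b) * (a - b) → (2 : ℝ)⁻¹ • (a + b - p) ∈ I
  dense_span : Dense (Submodule.span ℂ I : Set (Matrix (Fin 2) (Fin 2) ℂ))

/-- A closed convex cone with nonempty interior relative to the space `T` of traceless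
hermitian 2×2 matrices. -/
structure IsSolidClosedCone (C : Set (Matrix (Fin 2) (Fin 2) ℂ)) : Prop where
  subset : C ⊆ tracelessHermitian
  closed : IsClosed C
  add_mem : ∀ a ∈ C, ∀ b ∈ C, a + b ∈ C
  smul_mem : ∀ (r : ℝ), 0 ≤ r → ∀ a ∈ C, r • a ∈ C
  solid : ∃ U : Set (Matrix (Fin 2) (Fin 2) ℂ), IsOpen U ∧
    (U ∩ tracelessHermitian).Nonempty ∧ U ∩ tracelessHermitian ⊆ C

open Matrix

/-- Pauli coordinates of the traceless hermitian part of a matrix. -/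
def pauliCoords : Matrix (Fin 2) (Fin 2) ℂ →ₗ[ℝ] (Fin 3 → ℝ) where
  toFun m := ![((m 0 0).re - (m 1 1).re) / 2, ((m 0 1).re + (m 1 0).re) / 2,
    ((m 1 0).im - (m 0 1).im) / 2]
  map_add' x y := by
    ext i; fin_cases i <;> simp <;> ring
  map_smul' r x := by
    ext i; fin_cases i <;> simp <;> ring

/-- The traceless hermitian matrix with given Pauli coordinates. -/
def pauliMatrix : (Fin 3 → ℝ) →ₗ[ℝ] Matrix (Fin 2) (Fin 2) ℂ where
  toFun v := !![⟨v 0, 0⟩, ⟨v 1, -v 2⟩; ⟨v 1, v 2⟩, ⟨-v 0, 0⟩]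
  map_add' x y := by
    ext i j; fin_cases i <;> fin_cases j <;> simp [Complex.ext_iff] <;> ring
  map_smul' r x := by
    ext i j; fin_cases i <;> fin_cases j <;> simp [Complex.ext_iff]

lemma pauliCoords_pauliMatrix (v : Fin 3 → ℝ) : pauliCoords (pauliMatrix v) = v := by
  ext i; fin_cases i <;> simp [pauliCoords, pauliMatrix]

lemma isSelfAdjoint_fin_two_iff (m : Matrix (Fin 2) (Fin 2) ℂ) :
    IsSelfAdjoint m ↔ (m 0 0).im = 0 ∧ (m 1 1).im = 0 ∧ (m 1 0).re = (m 0 1).re ∧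
      (m 1 0).im = -(m 0 1).im := by
  rw [IsSelfAdjoint, ← Matrix.ext_iff]
  simp only [Fin.forall_fin_two, star_apply, Complex.ext_iff, Complex.star_def, Complex.conj_re,
    Complex.conj_im]
  constructor
  · rintro ⟨⟨h1, h2⟩, h3, h4⟩
    refine ⟨?_, ?_, ?_, ?_⟩ <;> linarith
  · rintro ⟨h1, h2, h3, h4⟩
    refine ⟨⟨⟨?_, ?_⟩, ?_, ?_⟩, ⟨?_, ?_⟩, ?_, ?_⟩ <;> first | trivial | linarith

lemma pauliMatrix_mem (v : Fin 3 → ℝ) : pauliMatrix v ∈ tracelessHermitian := by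
  refine ⟨(isSelfAdjoint_fin_two_iff _).2 ?_, ?_⟩ <;>
    simp [pauliMatrix, trace_fin_two, Complex.ext_iff]

lemma eq_pauliMatrix_add_of_isSelfAdjoint {m : Matrix (Fin 2) (Fin 2) ℂ} (hm : IsSelfAdjoint m) :
    m = pauliMatrix (pauliCoords m) + (m.trace.re / 2) • (1 : Matrix (Fin 2) (Fin 2) ℂ) := by
  obtain ⟨h1, h2, h3, h4⟩ := (isSelfAdjoint_fin_two_iff _).1 hm
  ext i j; fin_cases i <;> fin_cases j <;>
    simp [pauliMatrix, pauliCoords, trace_fin_two, Complex.ext_iff, *] <;>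
    ring

lemma pauliMatrix_pauliCoords {m : Matrix (Fin 2) (Fin 2) ℂ} (hm : m ∈ tracelessHermitian) :
    pauliMatrix (pauliCoords m) = m := by
  have h := eq_pauliMatrix_add_of_isSelfAdjoint hm.1
  rw [hm.2] at h
  simpa using h.symm

lemma isClosed_tracelessHermitian : IsClosed tracelessHermitian :=
  (isClosed_eq continuous_star continuous_id).inter
    (isClosed_eq continuous_id.matrix_trace continuous_const)

lemma continuous_pauliMatrix : Continuous pauliMatrix :=
  pauliMatrix.continuous_of_finiteDimensional

lemma continuous_pauliCoords : Continuous pauliCoords :=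
  pauliCoords.continuous_of_finiteDimensional

lemma interior_nonempty_iff_span_eq_top {E : Type*} [NormedAddCommGroup E] [NormedSpace ℝ E]
    [FiniteDimensional ℝ E] {C : Set E} (h0 : (0 : E) ∈ C) (hadd : ∀ a ∈ C, ∀ b ∈ C, a + b ∈ C)
    (hsmul : ∀ r : ℝ, 0 ≤ r → ∀ a ∈ C, r • a ∈ C) :
    (interior C).Nonempty ↔ Submodule.span ℝ C = ⊤ := by
  have hc : Convex ℝ C := fun x hx y hy a b ha hb _ =>
    hadd _ (hsmul a ha x hx) _ (hsmul b hb y hy)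
  rw [hc.interior_nonempty_iff_affineSpan_eq_top, ← Set.insert_eq_of_mem h0,
    ← SetLike.coe_set_eq, affineSpan_insert_zero, Set.insert_eq_of_mem h0,
    AffineSubspace.top_coe, Submodule.coe_eq_univ]

lemma trace_smul_self_fin_two (p : Matrix (Fin 2) (Fin 2) ℂ) :
    p.trace • p = p * p + p.det • (1 : Matrix (Fin 2) (Fin 2) ℂ) := by
  ext i j
  fin_cases i <;> fin_cases j <;> simp [trace_fin_two, det_fin_two, mul_apply] <;> ring

lemma trace_mul_self_fin_two (p : Matrix (Fin 2) (Fin 2) ℂ) :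
    (p * p).trace = p.trace * p.trace - 2 * p.det := by
  simp [trace_fin_two, det_fin_two, mul_apply]
  ring

lemma exists_ofReal_trace_det {d : Matrix (Fin 2) (Fin 2) ℂ} (hd : IsSelfAdjoint d) :
    ∃ t u : ℝ, d.trace = t ∧ d.det = u := by
  have ht : star d.trace = d.trace := by rw [← trace_conjTranspose, ← star_eq_conjTranspose, hd]
  have hu : star d.det = d.det := by rw [← det_conjTranspose, ← star_eq_conjTranspose, hd]
  exact ⟨_, _, (Complex.conj_eq_iff_re.1 ht).symm, (Complex.conj_eq_iff_re.1 hu).symm⟩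

lemma exists_eq_smul_add_smul_one_of_mul_self_eq {d p : Matrix (Fin 2) (Fin 2) ℂ}
    (hd : IsSelfAdjoint d) (hp : p.PosSemidef) (h : p * p = d * d) :
    ∃ t u : ℝ, |t| ≤ 1 ∧ p = t • d + u • (1 : Matrix (Fin 2) (Fin 2) ℂ) := by
  obtain ⟨τ, P, hτ, hP⟩ := exists_ofReal_trace_det hp.1.isSelfAdjoint
  obtain ⟨δ, D, hδ, hD⟩ := exists_ofReal_trace_det hd
  have hP0 : 0 ≤ P := by simpa [hP] using hp.det_nonneg
  have hτ0 : 0 ≤ τ := by simpa [hτ] using hp.trace_nonneg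
  rcases hτ0.eq_or_lt with h0 | h0
  · refine ⟨0, 0, by simp, ?_⟩
    rw [hp.trace_eq_zero_iff.1 (by simp [hτ, ← h0])]
    simp
  have hdet : P * P = D * D := by
    have : p.det * p.det = d.det * d.det := by rw [← det_mul, h, det_mul]
    rw [hP, hD] at this
    exact_mod_cast this
  have htr : τ * τ - 2 * P = δ * δ - 2 * D := by
    have := congrArg trace h
    rw [trace_mul_self_fin_two, trace_mul_self_fin_two, hτ, hP, hδ, hD] at this
    exact_mod_cast this
  have hDP : D ≤ P := abs_le_of_sq_le_sq' (by nlinarith) hP0 |>.2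
  refine ⟨δ / τ, (P - D) / τ, ?_, ?_⟩
  · rw [abs_div, abs_of_pos h0, div_le_one h0]
    exact abs_le_of_sq_le_sq (by nlinarith) hτ0
  · have e1 := trace_smul_self_fin_two p
    have e2 := trace_smul_self_fin_two d
    rw [hτ, hP, h] at e1
    rw [hδ, hD] at e2
    have e3 : τ • p = δ • d + (P - D) • (1 : Matrix (Fin 2) (Fin 2) ℂ) := by
      simp only [Complex.coe_smul] at e1 e2
      rw [e1, e2, sub_smul]
      abel
    rw [div_eq_inv_mul, div_eq_inv_mul, mul_smul, mul_smul, ← smul_add, ← e3,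
      inv_smul_smul₀ h0.ne']

lemma zero_mem_of_smul_mem {E : Type*} [AddCommGroup E] [Module ℝ E] {C : Set E}
    (hne : C.Nonempty) (hsmul : ∀ r : ℝ, 0 ≤ r → ∀ a ∈ C, r • a ∈ C) : (0 : E) ∈ C := by
  obtain ⟨a, ha⟩ := hne
  simpa using hsmul 0 le_rfl a ha

lemma isSolidClosedCone_iff_span_eq_top {C : Set (Matrix (Fin 2) (Fin 2) ℂ)}
    (hsub : C ⊆ tracelessHermitian) (hcl : IsClosed C) (h0 : 0 ∈ C)
    (hadd : ∀ a ∈ C, ∀ b ∈ C, a + b ∈ C) (hsmul : ∀ r : ℝ, 0 ≤ r → ∀ a ∈ C, r • a ∈ C) :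
    IsSolidClosedCone C ↔ Submodule.span ℝ (pauliMatrix ⁻¹' C) = ⊤ := by
  rw [← interior_nonempty_iff_span_eq_top (by simpa using h0)
    (fun a ha b hb => by simpa using hadd _ ha _ hb)
    (fun r hr a ha => by simpa using hsmul r hr _ ha)]
  constructor
  · intro hC
    obtain ⟨U, hU, ⟨x, hxU, hxT⟩, hUC⟩ := hC.solid
    refine ⟨pauliCoords x, mem_interior.2 ⟨pauliMatrix ⁻¹' U, fun v hv =>
      hUC ⟨hv, pauliMatrix_mem v⟩, hU.preimage continuous_pauliMatrix, ?_⟩⟩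
    simpa [pauliMatrix_pauliCoords hxT] using hxU
  · rintro ⟨v, hv⟩
    refine ⟨hsub, hcl, hadd, hsmul, pauliCoords ⁻¹' interior (pauliMatrix ⁻¹' C),
      isOpen_interior.preimage continuous_pauliCoords, ⟨pauliMatrix v, ?_, pauliMatrix_mem v⟩, ?_⟩
    · simpa [pauliCoords_pauliMatrix] using hv
    · rintro m ⟨hm, hmT⟩
      simpa [pauliMatrix_pauliCoords hmT] using interior_subset hm

lemma pauliCoords_I_smul {m : Matrix (Fin 2) (Fin 2) ℂ} (hm : IsSelfAdjoint m) :
    pauliCoords (Complex.I • m) = 0 := by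
  obtain ⟨h1, h2, h3, h4⟩ := (isSelfAdjoint_fin_two_iff _).1 hm
  ext i; fin_cases i <;> simp [pauliCoords, *]

lemma pauliCoords_smul (z : ℂ) (m : Matrix (Fin 2) (Fin 2) ℂ) :
    pauliCoords (z • m) = z.re • pauliCoords m + z.im • pauliCoords (Complex.I • m) := by
  ext i; fin_cases i <;> simp [pauliCoords] <;> ring

lemma pauliCoords_mem_span {I : Set (Matrix (Fin 2) (Fin 2) ℂ)} (hI : ∀ a ∈ I, IsSelfAdjoint a)
    {m : Matrix (Fin 2) (Fin 2) ℂ} (hm : m ∈ Submodule.span ℂ I) :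
    pauliCoords m ∈ Submodule.span ℝ (pauliCoords '' I) ∧
      pauliCoords (Complex.I • m) ∈ Submodule.span ℝ (pauliCoords '' I) := by
  induction hm using Submodule.span_induction with
  | mem x hx =>
    exact ⟨Submodule.subset_span ⟨x, hx, rfl⟩, by simp [pauliCoords_I_smul (hI x hx)]⟩
  | zero => simp
  | add x y _ _ hx hy =>
    rw [smul_add, map_add, map_add]
    exact ⟨add_mem hx.1 hy.1, add_mem hx.2 hy.2⟩
  | smul z x _ hx =>
    rw [smul_smul, pauliCoords_smul, pauliCoords_smul (Complex.I * z)]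
    exact ⟨add_mem (Submodule.smul_mem _ _ hx.1) (Submodule.smul_mem _ _ hx.2),
      add_mem (Submodule.smul_mem _ _ hx.1) (Submodule.smul_mem _ _ hx.2)⟩

lemma IsIsoconeM2.pauliMatrix_pauliCoords_mem {I : Set (Matrix (Fin 2) (Fin 2) ℂ)}
    (hI : IsIsoconeM2 I) {a : Matrix (Fin 2) (Fin 2) ℂ} (ha : a ∈ I) :
    pauliMatrix (pauliCoords a) ∈ I := by
  have h := hI.add_mem _ ha _ (hI.const_mem (-(a.trace.re / 2)))
  rwa [neg_smul, ← sub_eq_add_neg,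
    ← eq_sub_of_add_eq (eq_pauliMatrix_add_of_isSelfAdjoint (hI.selfAdjoint a ha)).symm] at h

lemma IsIsoconeM2.isSolidClosedCone {I : Set (Matrix (Fin 2) (Fin 2) ℂ)} (hI : IsIsoconeM2 I) :
    IsSolidClosedCone (I ∩ tracelessHermitian) := by
  have hspan : Submodule.span ℂ I = ⊤ := by
    have h := hI.dense_span.closure_eq
    rw [(Submodule.closed_of_finiteDimensional _).closure_eq] at h
    exact SetLike.coe_injective h
  refine (isSolidClosedCone_iff_span_eq_top Set.inter_subset_right
    (hI.closed.inter isClosed_tracelessHermitian) ⟨by simpa using hI.const_mem 0, ?_⟩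
    (fun a ha b hb => ⟨hI.add_mem a ha.1 b hb.1, ?_, ?_⟩)
    (fun r hr a ha => ⟨hI.smul_mem r hr a ha.1, ?_, ?_⟩)).2 ?_
  · simp [tracelessHermitian]
  · exact ha.2.1.add hb.2.1
  · simp [ha.2.2, hb.2.2]
  · exact (IsSelfAdjoint.all r).smul ha.2.1
  · simp [ha.2.2]
  · refine eq_top_iff.2 fun v _ => ?_
    have hv := (pauliCoords_mem_span hI.selfAdjoint (m := pauliMatrix v)
      (hspan ▸ Submodule.mem_top)).1
    rw [pauliCoords_pauliMatrix] at hv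
    refine Submodule.span_mono ?_ hv
    rintro _ ⟨a, ha, rfl⟩
    exact ⟨hI.pauliMatrix_pauliCoords_mem ha, pauliMatrix_mem _⟩

lemma trace_add_smul_one_re_div_two {c : Matrix (Fin 2) (Fin 2) ℂ} (hc : c ∈ tracelessHermitian)
    (r : ℝ) : (c + r • (1 : Matrix (Fin 2) (Fin 2) ℂ)).trace.re / 2 = r := by
  simp [hc.2]

lemma mem_add_smul_one_iff {C : Set (Matrix (Fin 2) (Fin 2) ℂ)} (hC : C ⊆ tracelessHermitian)
    (x : Matrix (Fin 2) (Fin 2) ℂ) :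
    (∃ c ∈ C, ∃ r : ℝ, x = c + r • (1 : Matrix (Fin 2) (Fin 2) ℂ)) ↔
      x - (x.trace.re / 2) • (1 : Matrix (Fin 2) (Fin 2) ℂ) ∈ C := by
  constructor
  · rintro ⟨c, hc, r, rfl⟩
    rw [trace_add_smul_one_re_div_two (hC hc), add_sub_cancel_right]
    exact hc
  · exact fun h => ⟨_, h, _, (sub_add_cancel _ _).symm⟩

lemma span_add_smul_one_eq_top {C : Set (Matrix (Fin 2) (Fin 2) ℂ)} (h0 : 0 ∈ C)
    (h : Submodule.span ℝ (pauliMatrix ⁻¹' C) = ⊤) :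
    Submodule.span ℂ {x | ∃ c ∈ C, ∃ r : ℝ, x = c + r • (1 : Matrix (Fin 2) (Fin 2) ℂ)} = ⊤ := by
  set S := Submodule.span ℂ {x | ∃ c ∈ C, ∃ r : ℝ, x = c + r • (1 : Matrix (Fin 2) (Fin 2) ℂ)}
  have hv (v : Fin 3 → ℝ) : pauliMatrix v ∈ S := by
    have hle : Submodule.span ℝ (pauliMatrix ⁻¹' C) ≤ (S.restrictScalars ℝ).comap pauliMatrix :=
      Submodule.span_le.2 fun w hw => Submodule.subset_span ⟨_, hw, 0, by simp⟩
    exact hle (h ▸ Submodule.mem_top)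
  have hone (r : ℝ) : r • (1 : Matrix (Fin 2) (Fin 2) ℂ) ∈ S :=
    Submodule.subset_span ⟨0, h0, r, by simp⟩
  have hsa {m : Matrix (Fin 2) (Fin 2) ℂ} (hm : IsSelfAdjoint m) : m ∈ S := by
    rw [eq_pauliMatrix_add_of_isSelfAdjoint hm]
    exact add_mem (hv _) (hone _)
  refine eq_top_iff.2 fun m _ => ?_
  rw [← realPart_add_I_smul_imaginaryPart m]
  exact add_mem (hsa (realPart m).2) (S.smul_mem _ (hsa (imaginaryPart m).2))

lemma IsSolidClosedCone.isIsoconeM2 {C : Set (Matrix (Fin 2) (Fin 2) ℂ)}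
    (hC : IsSolidClosedCone C) :
    IsIsoconeM2 {x | ∃ c ∈ C, ∃ r : ℝ, x = c + r • (1 : Matrix (Fin 2) (Fin 2) ℂ)} := by
  have h0 : (0 : Matrix (Fin 2) (Fin 2) ℂ) ∈ C :=
    zero_mem_of_smul_mem (hC.solid.elim fun _ hU => hU.2.1.mono hU.2.2) hC.smul_mem
  set J := {x | ∃ c ∈ C, ∃ r : ℝ, x = c + r • (1 : Matrix (Fin 2) (Fin 2) ℂ)}
  have hsa : ∀ a ∈ J, IsSelfAdjoint a := by
    rintro _ ⟨c, hc, r, rfl⟩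
    exact (hC.subset hc).1.add ((IsSelfAdjoint.all r).smul (.one _))
  have hadd : ∀ a ∈ J, ∀ b ∈ J, a + b ∈ J := by
    rintro _ ⟨c, hc, r, rfl⟩ _ ⟨d, hd, s, rfl⟩
    exact ⟨c + d, hC.add_mem c hc d hd, r + s, by rw [add_smul]; abel⟩
  have hsmul : ∀ r : ℝ, 0 ≤ r → ∀ a ∈ J, r • a ∈ J := by
    rintro r hr _ ⟨c, hc, s, rfl⟩
    exact ⟨r • c, hC.smul_mem r hr c hc, r * s, by rw [smul_add, smul_smul]⟩
  have hone (r : ℝ) : r • (1 : Matrix (Fin 2) (Fin 2) ℂ) ∈ J := ⟨0, h0, r, by simp⟩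
  have hcomb : ∀ a ∈ J, ∀ b ∈ J, ∀ t u : ℝ, |t| ≤ 1 →
      (2 : ℝ)⁻¹ • (a + b + (t • (a - b) + u • (1 : Matrix (Fin 2) (Fin 2) ℂ))) ∈ J := by
    intro a ha b hb t u ht
    obtain ⟨h1, h2⟩ := abs_le.1 ht
    have h := hsmul 2⁻¹ (by norm_num) _ (hadd _ (hadd _ (hsmul (1 + t) (by linarith) a ha) _
      (hsmul (1 - t) (by linarith) b hb)) _ (hone u))
    convert h using 2
    module
  refine ⟨hsa, ?_, hadd, hsmul, hone, ?_, ?_, ?_⟩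
  · have hJ : J = (fun x : Matrix (Fin 2) (Fin 2) ℂ =>
        x - (x.trace.re / 2) • (1 : Matrix (Fin 2) (Fin 2) ℂ)) ⁻¹' C :=
      Set.ext fun x => mem_add_smul_one_iff hC.subset x
    rw [hJ]
    refine hC.closed.preimage ?_
    have h : Continuous fun x : Matrix (Fin 2) (Fin 2) ℂ => x.trace.re / 2 :=
      (Complex.continuous_re.comp continuous_id.matrix_trace).div_const 2
    exact continuous_id.sub (h.smul continuous_const)
  · intro a ha b hb p hp h
    obtain ⟨t, u, ht, rfl⟩ :=
      exists_eq_smul_add_smul_one_of_mul_self_eq ((hsa a ha).sub (hsa b hb)) hp h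
    exact hcomb a ha b hb t u ht
  · intro a ha b hb p hp h
    obtain ⟨t, u, ht, rfl⟩ :=
      exists_eq_smul_add_smul_one_of_mul_self_eq ((hsa a ha).sub (hsa b hb)) hp h
    convert hcomb a ha b hb (-t) (-u) (by rwa [abs_neg]) using 2
    module
  · rw [span_add_smul_one_eq_top h0 ((isSolidClosedCone_iff_span_eq_top hC.subset hC.closed h0
      hC.add_mem hC.smul_mem).1 hC)]
    exact dense_univ

/-- **Classification of the isocones of `M₂(ℂ)`.**  The map `I ↦ I ∩ T`, where `T` is
the space of traceless hermitian matrices, is a bijection from the isocones of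
`M₂(ℂ)` onto the closed convex cones with nonempty interior in `T`, with inverse
`C ↦ C + ℝ·1`. -/
theorem stmt_18 :
    (∀ I : Set (Matrix (Fin 2) (Fin 2) ℂ), IsIsoconeM2 I →
      IsSolidClosedCone (I ∩ tracelessHermitian)) ∧
    (∀ I : Set (Matrix (Fin 2) (Fin 2) ℂ), IsIsoconeM2 I →
      I = {x | ∃ c ∈ I ∩ tracelessHermitian, ∃ r : ℝ,
        x = c + r • (1 : Matrix (Fin 2) (Fin 2) ℂ)}) ∧
    (∀ C : Set (Matrix (Fin 2) (Fin 2) ℂ), IsSolidClosedCone C →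
      IsIsoconeM2 {x | ∃ c ∈ C, ∃ r : ℝ, x = c + r • (1 : Matrix (Fin 2) (Fin 2) ℂ)} ∧
      {x | ∃ c ∈ C, ∃ r : ℝ, x = c + r • (1 : Matrix (Fin 2) (Fin 2) ℂ)} ∩
        tracelessHermitian = C) := by
  refine ⟨fun I hI => hI.isSolidClosedCone, fun I hI => ?_, fun C hC => ⟨hC.isIsoconeM2, ?_⟩⟩
  · ext x
    constructor
    · exact fun hx => ⟨_, ⟨hI.pauliMatrix_pauliCoords_mem hx, pauliMatrix_mem _⟩, _,
        eq_pauliMatrix_add_of_isSelfAdjoint (hI.selfAdjoint x hx)⟩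
    · rintro ⟨c, hc, r, rfl⟩
      exact hI.add_mem _ hc.1 _ (hI.const_mem r)
  · ext x
    constructor
    · rintro ⟨hx, hxT⟩
      simpa [hxT.2] using (mem_add_smul_one_iff hC.subset x).1 hx
    · exact fun hx => ⟨⟨x, hx, 0, by simp⟩, hC.subset hx⟩

end
end
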